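/- For every integer m ≥ 3, ω(m) ≤ 1.3841 · log m / log log m, where ω(m) is the number of distinct prime divisors of m. -/

import Mathlib

/-- The primes up to `N`. -/
def primesUpTo (N : ℕ) : Finset ℕ := (Finset.range (N + 1)).filter Nat.Prime

lemma card_primesUpTo_small :
    ∀ n < 100, 30 ≤ n → 10000 * (primesUpTo n).card ≤ 3841 * n := by
  decide +kernel

lemma card_primesUpTo_eq (n : ℕ) : (primesUpTo n).card = Nat.primeCounting n := by
  rw [Nat.primeCounting, Nat.primeCounting', Nat.count_eq_card_filter_range, primesUpTo]

/-- A crude sieve bound modulo 30. -/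
lemma card_primesUpTo_le (n : ℕ) (hn : 30 ≤ n) :
    10000 * (primesUpTo n).card ≤ 3841 * n := by
  by_cases h : n < 100
  · exact card_primesUpTo_small n h hn
  · obtain ⟨j, rfl⟩ := Nat.exists_eq_add_of_le hn
    have h1 := Nat.primeCounting_add_le (a := 30) (k := 30) (by norm_num) le_rfl j
    rw [← card_primesUpTo_eq, ← card_primesUpTo_eq] at h1
    have h2 : (primesUpTo 30).card = 10 := by decide +kernel
    have h3 : Nat.totient 30 = 8 := by decide +kernel
    rw [h2, h3] at h1
    omega

/-- `D N y = ∑_{p ≤ N} log (y / p)`. -/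
noncomputable def dsum (N : ℕ) (y : ℝ) : ℝ := ∑ p ∈ primesUpTo N, (Real.log y - Real.log p)

/-- The key lower bound for `log m`. -/
lemma key_bound (m : ℕ) (hm : m ≠ 0) (N : ℕ) (y : ℝ) (h1 : (N : ℝ) ≤ y) (h2 : y ≤ N + 1)
    (hN : 1 ≤ N) :
    (m.primeFactors.card : ℝ) * Real.log y ≤ Real.log m + dsum N y := by
  have hy : 0 < y := by
    have : (1 : ℝ) ≤ N := by exact_mod_cast hN
    linarith
  have hle : ∑ p ∈ m.primeFactors, Real.log p ≤ Real.log m := by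
    rw [← Real.log_prod (fun p hp => by
      have := (Nat.prime_of_mem_primeFactors hp).pos
      positivity)]
    apply Real.log_le_log
    · apply Finset.prod_pos
      intro p hp
      have := (Nat.prime_of_mem_primeFactors hp).pos
      positivity
    · rw [← Nat.cast_prod]
      exact Nat.cast_le.mpr
        (Nat.le_of_dvd (Nat.pos_of_ne_zero hm) (Nat.prod_primeFactors_dvd m))
  have hs : ∑ p ∈ m.primeFactors, (Real.log y - Real.log p) ≤ dsum N y := by
    rw [← Finset.sum_filter_add_sum_filter_not m.primeFactors (fun p => p ≤ N)]
    have ha : ∑ p ∈ m.primeFactors.filter (fun p => p ≤ N), (Real.log y - Real.log p)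
        ≤ dsum N y := by
      apply Finset.sum_le_sum_of_subset_of_nonneg
      · intro p hp
        simp only [Finset.mem_filter, primesUpTo, Finset.mem_range] at hp ⊢
        exact ⟨by omega, Nat.prime_of_mem_primeFactors hp.1⟩
      · intro p hp _
        simp only [Finset.mem_filter, primesUpTo, Finset.mem_range] at hp
        have hp0 : (0 : ℝ) < p := by exact_mod_cast hp.2.pos
        have : (p : ℝ) ≤ N := by exact_mod_cast (by omega : p ≤ N)
        have := Real.log_le_log hp0 (this.trans h1)
        linarith
    have hb : ∑ p ∈ m.primeFactors.filter (fun p => ¬ p ≤ N), (Real.log y - Real.log p) ≤ 0 := by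
      apply Finset.sum_nonpos
      intro p hp
      simp only [Finset.mem_filter] at hp
      have : (N : ℝ) + 1 ≤ p := by exact_mod_cast (by omega : N + 1 ≤ p)
      have := Real.log_le_log hy (h2.trans this)
      linarith
    linarith
  rw [Finset.sum_sub_distrib, Finset.sum_const, nsmul_eq_mul] at hs
  linarith

lemma dsum_eq (N : ℕ) (y : ℝ) :
    dsum N y = (primesUpTo N).card * Real.log y - Real.log (∏ p ∈ primesUpTo N, p : ℕ) := by
  rw [dsum, Finset.sum_sub_distrib, Finset.sum_const, nsmul_eq_mul]
  push_cast
  rw [Real.log_prod]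
  intro p hp
  simp only [Finset.mem_filter, primesUpTo] at hp
  have := hp.2.pos
  positivity

lemma exp_upper (n : ℕ) (f B : ℝ) (h0 : 0 ≤ f) (h1 : f ≤ 1)
    (h : (2.7182818286 : ℝ) ^ n * (1 + f + f ^ 2 / 2 + f ^ 3 / 6 + f ^ 4 / 24 + f ^ 5 / 100) ≤ B) :
    Real.exp (n + f) ≤ B := by
  rw [Real.exp_add, ← Real.exp_one_pow]
  have h2 := Real.exp_bound' h0 h1 (n := 5) (by norm_num)
  simp only [Finset.sum_range_succ, Finset.sum_range_zero, Nat.factorial] at h2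
  norm_num at h2
  refine le_trans (mul_le_mul ?_ ?_ (Real.exp_pos _).le (by positivity)) h
  · gcongr
    exact Real.exp_one_lt_d9.le
  · linarith

lemma dsum_thirty : dsum 30 30 ≤ 11.523 := by
  rw [dsum_eq]
  have h2 : (primesUpTo 30).card = 10 := by decide +kernel
  have h3 : ∏ p ∈ primesUpTo 30, p = 6469693230 := by decide +kernel
  rw [h2, h3]
  have h4 : (10 : ℕ) * Real.log 30 = Real.log ((30 : ℝ) ^ 10) := by
    rw [Real.log_pow]
  rw [h4, ← Real.log_div (by norm_num) (by norm_num), Real.log_le_iff_le_exp (by norm_num)]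
  have h5 : Real.exp (11.523 : ℝ) = Real.exp 1 ^ 11 * Real.exp 0.523 := by
    rw [Real.exp_one_pow, ← Real.exp_add]
    norm_num
  rw [h5]
  have h6 : (2.71828 : ℝ) ^ 11 ≤ Real.exp 1 ^ 11 := by
    gcongr
    have := Real.exp_one_gt_d9
    linarith
  have h7 := Real.quadratic_le_exp_of_nonneg (x := 0.523) (by norm_num)
  refine le_trans ?_ (mul_le_mul h6 h7 (by norm_num) (by positivity))
  norm_num

lemma dsum_step (N : ℕ) (hN : 30 ≤ N) (y : ℝ) (hy : (N : ℝ) ≤ y) :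
    dsum N y ≤ dsum N N + 0.3841 * (y - N) := by
  have hN0 : (0 : ℝ) < N := by
    have : (30 : ℝ) ≤ N := by exact_mod_cast hN
    linarith
  rw [dsum_eq, dsum_eq]
  have h1 : Real.log y - Real.log N ≤ (y - N) / N := by
    rw [← Real.log_div (by linarith) hN0.ne']
    have := Real.log_le_sub_one_of_pos (x := y / N) (by apply div_pos <;> linarith)
    rw [sub_div, div_self hN0.ne']
    exact this
  have h2 : ((primesUpTo N).card : ℝ) ≤ 0.3841 * N := by
    have : (10000 * (primesUpTo N).card : ℝ) ≤ 3841 * N := by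
      exact_mod_cast card_primesUpTo_le N hN
    linarith
  have h3 : ((primesUpTo N).card : ℝ) * (Real.log y - Real.log N)
      ≤ 0.3841 * N * ((y - N) / N) := by
    refine (mul_le_mul_of_nonneg_left h1 (by positivity)).trans ?_
    exact mul_le_mul_of_nonneg_right h2 (div_nonneg (by linarith) hN0.le)
  have h4 : 0.3841 * N * ((y - N) / N) = 0.3841 * (y - N) := by
    field_simp
  rw [h4] at h3
  linarith

lemma dsum_succ (N : ℕ) : dsum (N + 1) (N + 1 : ℕ) = dsum N (N + 1 : ℕ) := by
  unfold dsum primesUpTo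
  rw [Finset.range_add_one (n := N + 1), Finset.filter_insert]
  split_ifs
  · rw [Finset.sum_insert (by simp)]
    simp
  · rfl

lemma dsum_nat (N : ℕ) (hN : 30 ≤ N) : dsum N N ≤ 0.3841 * N := by
  induction N, hN using Nat.le_induction with
  | base =>
    have := dsum_thirty
    norm_num at this ⊢
    linarith
  | succ n hn ih =>
    rw [dsum_succ]
    have := dsum_step n hn (n + 1 : ℕ) (by push_cast; linarith)
    push_cast at this ⊢
    linarith

/-- The tangent-line numerical criterion. -/
lemma finish_bound (k L s E r : ℝ) (hk : 0 ≤ k) (hr : 0 < r) (hL : r ≤ L) (hE : 0 < E)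
    (hs : E ≤ Real.exp s) (hkE : k / E ≤ 1.3841) (h : k * (s - 1) ≤ r * (1.3841 - k / E)) :
    k * Real.log L ≤ 1.3841 * L := by
  have hL0 : 0 < L := by linarith
  have h1 : Real.log L ≤ s + L / E - 1 := by
    have := Real.log_le_sub_one_of_pos (x := L / Real.exp s) (by positivity)
    rw [Real.log_div hL0.ne' (Real.exp_pos s).ne', Real.log_exp] at this
    have h2 : L / Real.exp s ≤ L / E := by gcongr
    linarith
  have h2 := mul_le_mul_of_nonneg_left h1 hk
  have h3 : r * (1.3841 - k / E) ≤ L * (1.3841 - k / E) :=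
    mul_le_mul_of_nonneg_right hL (by linarith)
  have h4 : k * (s + L / E - 1) = k * (s - 1) + L * (k / E) := by ring
  linarith

lemma exp_lower (s E : ℝ) (hs : 0 ≤ s)
    (h : E ≤ ∑ i ∈ Finset.range 18, s ^ i / (i.factorial : ℝ)) : E ≤ Real.exp s :=
  h.trans (Real.sum_le_exp_of_nonneg hs 18)

/-- Treats `ω(m) = k` where `k = π(N)` and `Q` is the primorial of `N`. -/
lemma case_bound (m : ℕ) (hm : m ≠ 0) (N k Q : ℕ) (hN : 1 ≤ N)
    (hk : m.primeFactors.card = k) (hc : (primesUpTo N).card = k)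
    (hQ : ∏ p ∈ primesUpTo N, p = Q) (hQ0 : 0 < Q) (n : ℕ) (f s E : ℝ) (hf0 : 0 ≤ f)
    (hn : 1 ≤ n) (hf1 : f ≤ 1)
    (h1 : (2.7182818286 : ℝ) ^ n * (1 + f + f ^ 2 / 2 + f ^ 3 / 6 + f ^ 4 / 24 + f ^ 5 / 100) ≤ Q)
    (hs : 0 ≤ s) (hE0 : 0 < E) (hE : E ≤ ∑ i ∈ Finset.range 18, s ^ i / (i.factorial : ℝ))
    (hkE : (k : ℝ) / E ≤ 1.3841) (h : k * (s - 1) ≤ (n + f) * (1.3841 - k / E)) :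
    (m.primeFactors.card : ℝ) * Real.log (Real.log m) ≤ 1.3841 * Real.log m := by
  have hb := key_bound m hm N N le_rfl (by linarith) hN
  rw [dsum_eq, hc, hQ, hk] at hb
  have h2 : (n : ℝ) + f ≤ Real.log Q := by
    rw [Real.le_log_iff_exp_le (by exact_mod_cast hQ0)]
    exact exp_upper n f Q hf0 hf1 h1
  have hn' : (1 : ℝ) ≤ n := by exact_mod_cast hn
  rw [hk]
  exact finish_bound k _ s E (n + f) (by positivity) (by linarith) (by linarith) hE0
    (exp_lower s E hs hE) hkE h

lemma main_bound (m : ℕ) (hm : 3 ≤ m) :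
    (m.primeFactors.card : ℝ) * Real.log (Real.log m) ≤ 1.3841 * Real.log m := by
  have hm0 : m ≠ 0 := by omega
  by_cases hL : 30 ≤ Real.log m
  · set L := Real.log m with hLdef
    have h1 : (⌊L⌋₊ : ℝ) ≤ L := Nat.floor_le (by linarith)
    have h2 : L ≤ ⌊L⌋₊ + 1 := (Nat.lt_floor_add_one L).le
    have h3 : 30 ≤ ⌊L⌋₊ := Nat.le_floor (by exact_mod_cast hL)
    have h4 := key_bound m hm0 ⌊L⌋₊ L h1 h2 (by omega)
    have h5 := dsum_step ⌊L⌋₊ h3 L h1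
    have h6 := dsum_nat ⌊L⌋₊ h3
    linarith
  · push Not at hL
    have hk : m.primeFactors.card ≤ 12 := by
      have h4 := key_bound m hm0 30 30 (by norm_num) (by norm_num) (by norm_num)
      have h5 := dsum_thirty
      have h6 : (3.2 : ℝ) ≤ Real.log 30 := by
        rw [Real.le_log_iff_exp_le (by norm_num)]
        have := exp_upper 3 0.2 30 (by norm_num) (by norm_num) (by norm_num)
        norm_num at this ⊢
        exact this
      by_contra hcon
      have h7 : (13 : ℝ) ≤ m.primeFactors.card := by exact_mod_cast (by omega)
      nlinarith
    have hLpos : 1 < Real.log m := by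
      rw [Real.lt_log_iff_exp_lt (by positivity)]
      have := Real.exp_one_lt_d9
      have h3 : (3 : ℝ) ≤ m := by exact_mod_cast hm
      linarith
    generalize hkk : m.primeFactors.card = k at hk
    by_cases hk3 : k ≤ 3
    · have hk' : (k : ℝ) ≤ 3 := by exact_mod_cast hk3
      have h8 := finish_bound 3 (Real.log m) 1 2.7 1 (by norm_num) (by norm_num) hLpos.le
        (by norm_num) (by have := Real.exp_one_gt_d9; linarith) (by norm_num) (by norm_num)
      have h9 := mul_le_mul_of_nonneg_right hk' (Real.log_nonneg hLpos.le)
      linarith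
    · rw [← hkk]
      push Not at hk3
      interval_cases k
      · exact case_bound m hm0 7 4 210 (by norm_num) hkk (by decide +kernel)
          (by decide +kernel) (by norm_num) 5 0.346 1.677 5.3491 (by norm_num) (by norm_num)
          (by norm_num) (by norm_num) (by norm_num) (by norm_num)
          (by norm_num [Finset.sum_range_succ, Nat.factorial]) (by norm_num) (by norm_num)
      · exact case_bound m hm0 11 5 2310 (by norm_num) hkk (by decide +kernel)
          (by decide +kernel) (by norm_num) 7 0.744 2.047 7.7443 (by norm_num) (by norm_num)
          (by norm_num) (by norm_num) (by norm_num) (by norm_num)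
          (by norm_num [Finset.sum_range_succ, Nat.factorial]) (by norm_num) (by norm_num)
      · exact case_bound m hm0 13 6 30030 (by norm_num) hkk (by decide +kernel)
          (by decide +kernel) (by norm_num) 10 0.309 2.333 10.3085 (by norm_num) (by norm_num)
          (by norm_num) (by norm_num) (by norm_num) (by norm_num)
          (by norm_num [Finset.sum_range_succ, Nat.factorial]) (by norm_num) (by norm_num)
      · exact case_bound m hm0 17 7 510510 (by norm_num) hkk (by decide +kernel)
          (by decide +kernel) (by norm_num) 13 0.142 2.576 13.1441 (by norm_num) (by norm_num)
          (by norm_num) (by norm_num) (by norm_num) (by norm_num)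
          (by norm_num [Finset.sum_range_succ, Nat.factorial]) (by norm_num) (by norm_num)
      · exact case_bound m hm0 19 8 9699690 (by norm_num) hkk (by decide +kernel)
          (by decide +kernel) (by norm_num) 16 0.086 2.778 16.0865 (by norm_num) (by norm_num)
          (by norm_num) (by norm_num) (by norm_num) (by norm_num)
          (by norm_num [Finset.sum_range_succ, Nat.factorial]) (by norm_num) (by norm_num)
      · exact case_bound m hm0 23 9 223092870 (by norm_num) hkk (by decide +kernel)
          (by decide +kernel) (by norm_num) 19 0.222 2.956 19.2206 (by norm_num) (by norm_num)
          (by norm_num) (by norm_num) (by norm_num) (by norm_num)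
          (by norm_num [Finset.sum_range_succ, Nat.factorial]) (by norm_num) (by norm_num)
      · exact case_bound m hm0 29 10 6469693230 (by norm_num) hkk (by decide +kernel)
          (by decide +kernel) (by norm_num) 22 0.589 3.118 22.6008 (by norm_num) (by norm_num)
          (by norm_num) (by norm_num) (by norm_num) (by norm_num)
          (by norm_num [Finset.sum_range_succ, Nat.factorial]) (by norm_num) (by norm_num)
      · exact case_bound m hm0 31 11 200560490130 (by norm_num) hkk (by decide +kernel)
          (by decide +kernel) (by norm_num) 26 0.023 3.259 26.0232 (by norm_num) (by norm_num)
          (by norm_num) (by norm_num) (by norm_num) (by norm_num)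
          (by norm_num [Finset.sum_range_succ, Nat.factorial]) (by norm_num) (by norm_num)
      · exact case_bound m hm0 37 12 7420738134810 (by norm_num) hkk (by decide +kernel)
          (by decide +kernel) (by norm_num) 29 0.634 3.389 29.6360 (by norm_num) (by norm_num)
          (by norm_num) (by norm_num) (by norm_num) (by norm_num)
          (by norm_num [Finset.sum_range_succ, Nat.factorial]) (by norm_num) (by norm_num)

/-- Robin's explicit bound: for every integer `m ≥ 3`,
`ω(m) ≤ 1.3841 · log m / log log m`. -/
theorem stmt_13 (m : ℕ) (hm : 3 ≤ m) :
    (m.primeFactors.card : ℝ) ≤ 1.3841 * Real.log m / Real.log (Real.log m) := by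
  have hLpos : 1 < Real.log m := by
    rw [Real.lt_log_iff_exp_lt (by positivity)]
    have := Real.exp_one_lt_d9
    have h3 : (3 : ℝ) ≤ m := by exact_mod_cast hm
    linarith
  rw [le_div_iff₀ (Real.log_pos hLpos)]
  exact main_bound m hm
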